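/- arXiv:math/0410406 — 2 statements merged into one kernel-verified Lean document; each statement's English description precedes it below -/
import Mathlib

section
/- Let X be an infinite set of singular cardinality κ = ℵ_α with λ = max(|α|, ℵ₀) = κ. Then the interval [S, A'] of submonoids of the full transformation monoid O^(1) between the permutations S and the monoid A' has cardinality 2^(κ^{<κ}), where κ^{<κ} = sup{κ^ξ : ξ a cardinal, ξ < κ}. -/
open Cardinal

universe u

/-- The submonoid of all permutations inside the full transformation monoid `Function.End X`. -/
def permSubmonoid (X : Type u) : Submonoid (Function.End X) where
  carrier := {f | Function.Bijective f}
  mul_mem' hf hg := hf.comp hg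
  one_mem' := Function.bijective_id

/-- A submonoid `C ≠ O⁽¹⁾` is precomplete iff together with any function outside of it,
it generates the full transformation monoid. -/
def Precomplete {X : Type u} (C : Submonoid (Function.End X)) : Prop :=
  C ≠ ⊤ ∧ ∀ f : Function.End X, f ∉ C →
    Submonoid.closure ((C : Set (Function.End X)) ∪ {f}) = ⊤

/-- `f` is `ξ`-injective: `f` is injective off a set of cardinality `< ξ`. -/
def XiInjective {X : Type u} (ξ : Cardinal.{u}) (f : Function.End X) : Prop :=
  ∃ Y : Set X, #Y < ξ ∧ Set.InjOn f Yᶜ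

/-- `f` is `ξ`-surjective: the complement of its range has cardinality `< ξ`. -/
def XiSurjective {X : Type u} (ξ : Cardinal.{u}) (f : Function.End X) : Prop :=
  #((Set.range f)ᶜ : Set X) < ξ

/-- The set `A` of functions almost all of whose fibers are small. -/
def monA (X : Type u) : Set (Function.End X) :=
  {f | #{y : X | ¬ #(f ⁻¹' {y}) < #X} < #X}

/-- The set `A'` of functions `f` such that for some `ξ < |X|`, almost all fibers of `f`
have cardinality at most `ξ`. -/
def monA' (X : Type u) : Set (Function.End X) :=
  {f | ∃ ξ : Cardinal.{u}, ξ < #X ∧ #{x : X | ¬ #(f ⁻¹' {x}) ≤ ξ} < #X}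

/-- The set `G_ξ` of functions which are `ξ`-injective or not `ξ`-surjective. -/
def monG (X : Type u) (ξ : Cardinal.{u}) : Set (Function.End X) :=
  {f | XiInjective ξ f ∨ ¬ XiSurjective ξ f}

/-- The set `M_ξ` of functions which are `ξ`-surjective or not `ξ`-injective. -/
def monM (X : Type u) (ξ : Cardinal.{u}) : Set (Function.End X) :=
  {f | XiSurjective ξ f ∨ ¬ XiInjective ξ f}

/-- The kernel sequence of `f` assigns to every cardinal `ξ` the number of
(nonempty) fibers of `f` of cardinality `ξ`. -/
noncomputable def kernelSeq {X : Type u} (f : X → X) (ξ : Cardinal.{u}) : Cardinal.{u} :=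
  #{A : Set X // (∃ y : X, A = f ⁻¹' {y}) ∧ A.Nonempty ∧ #A = ξ}

/-- The set `R`: the range of the sequence `(n i)` together with all infinite
successor cardinals `≤ κ`. -/
def setR (κ : Cardinal.{u}) (n : ℕ → ℕ) : Set Cardinal.{u} :=
  (Set.range fun i : ℕ => (n i : Cardinal.{u})) ∪
    {ξ | ℵ₀ ≤ ξ ∧ ξ ≤ κ ∧ ∃ μ : Cardinal.{u}, ξ = Order.succ μ}

/-- The sum of a set of cardinals. -/
noncomputable def setSum (A : Set Cardinal.{u}) : Cardinal.{u + 1} :=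
  Cardinal.sum fun η : A => (η : Cardinal.{u})

open Set in
theorem exists_mk_Iio_toType_eq {c κ : Cardinal.{u}} (h : c < κ) :
    ∃ i : κ.ord.ToType, #(Iio i) = c := by
  have hc : c.ord < Ordinal.type ((· < ·) : κ.ord.ToType → κ.ord.ToType → Prop) := by
    simpa using Cardinal.ord_lt_ord.2 h
  refine ⟨Ordinal.enum (· < ·) ⟨c.ord, hc⟩, ?_⟩
  refine (Ordinal.card_typein (r := ((· < ·) : κ.ord.ToType → κ.ord.ToType → Prop)) _).symm.trans ?_
  rw [Ordinal.typein_enum, Cardinal.card_ord]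

open Set in
theorem mk_Iic_toType_lt {κ : Cardinal.{u}} (hκ : ℵ₀ ≤ κ) (i : κ.ord.ToType) :
    #(Iic i) < κ := by
  simpa using Cardinal.mk_Iic_lt i (by simp) (by simpa using hκ)

/-- There are at most `ξ + 1` cardinals `≤ ξ`. -/
theorem mk_Iic_cardinal_le (ξ : Cardinal.{u}) :
    #(Set.Iic ξ) ≤ Cardinal.lift.{u + 1} (ξ + 1) := by
  have h : #(Set.Iic ξ) ≤ #(Set.Iio (ξ.ord + 1)) := by
    refine Cardinal.mk_le_of_injective
      (f := fun μ => ⟨μ.1.ord, Order.lt_add_one_iff.2 (Cardinal.ord_le_ord.2 μ.2)⟩) ?_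
    intro a b hab
    exact Subtype.ext (Cardinal.ord_injective (congrArg Subtype.val hab))
  rw [Cardinal.mk_Iio_ordinal] at h
  simpa using h

/-- A set of cardinality `κ` has at most `κ ^< κ` subsets of cardinality less than `κ`. -/
theorem mk_small_subsets_le {Z : Type u} {κ : Cardinal.{u}} (hκ : ℵ₀ ≤ κ) (hZ : #Z = κ) :
    #{s : Set Z // #s < κ} ≤ κ ^< κ := by
  have hinf : Infinite Z := Cardinal.infinite_iff.2 (hZ ▸ hκ)
  choose i hi using fun s : {s : Set Z // #s < κ} => exists_mk_Iio_toType_eq s.2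
  have h1 : #{s : Set Z // #s < κ} ≤
      #(Σ i : κ.ord.ToType, {s : Set Z // #s ≤ #(Set.Iio i)}) := by
    refine Cardinal.mk_le_of_injective (f := fun s => ⟨i s, s.1, (hi s).ge⟩) ?_
    intro s t hst
    have : ∀ p q : (Σ i : κ.ord.ToType, {s : Set Z // #s ≤ #(Set.Iio i)}),
        p = q → p.2.1 = q.2.1 := by rintro p _ rfl; rfl
    exact Subtype.ext (this _ _ hst)
  have hle : κ ≤ κ ^< κ := by
    simpa using Cardinal.le_powerlt κ (Cardinal.one_lt_aleph0.trans_le hκ)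
  refine h1.trans ?_
  rw [Cardinal.mk_sigma]
  calc
    _ ≤ Cardinal.sum fun _ : κ.ord.ToType => κ ^< κ := by
        refine Cardinal.sum_le_sum _ _ fun i => ?_
        refine (Cardinal.mk_bounded_set_le_of_infinite Z _).trans ?_
        rw [hZ]
        refine Cardinal.le_powerlt κ ?_
        simpa using Cardinal.mk_Iio_lt i (by simp)
    _ = κ * κ ^< κ := by simp
    _ = κ ^< κ := Cardinal.mul_eq_right (hκ.trans hle) hle
        (Cardinal.aleph0_pos.trans_le hκ).ne'

/-- Two maps whose fibers of each cardinality are equally numerous agree up to permutations of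
the domain and the codomain. -/
theorem exists_perm_of_mk_fibers_eq {X : Type u} {f g : X → X}
    (h : ∀ μ : Cardinal.{u}, #{y : X | #(f ⁻¹' {y}) = μ} = #{y : X | #(g ⁻¹' {y}) = μ}) :
    ∃ σ τ : Equiv.Perm X, g ∘ τ = σ ∘ f := by
  have e : ∀ μ : Cardinal.{u}, {y : X // #(f ⁻¹' {y}) = μ} ≃ {y : X // #(g ⁻¹' {y}) = μ} :=
    fun μ => Classical.choice (Cardinal.eq.1 (h μ))
  let σ : Equiv.Perm X := Equiv.ofFiberEquiv e
  have hσ : ∀ y, #(g ⁻¹' {σ y}) = #(f ⁻¹' {y}) := fun y => Equiv.ofFiberEquiv_map e y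
  have e' : ∀ z, {x // σ (f x) = z} ≃ {x // g x = z} := by
    intro z
    have h1 := hσ (σ.symm z)
    rw [Equiv.apply_symm_apply] at h1
    have h2 : {x | σ (f x) = z} = f ⁻¹' {σ.symm z} := by
      ext x
      simp [Equiv.eq_symm_apply]
    refine Classical.choice (Cardinal.eq.1 ?_)
    change #{x | σ (f x) = z} = #(g ⁻¹' {z})
    rw [h2, h1]
  exact ⟨σ, Equiv.ofFiberEquiv e', funext fun x => Equiv.ofFiberEquiv_map e' x⟩

/-- A submonoid containing the permutations is closed under changing a map by permutations. -/
theorem mem_of_mk_fibers_eq {X : Type u} {M : Submonoid (Function.End X)}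
    (hM : permSubmonoid X ≤ M) {f g : Function.End X} (hf : f ∈ M)
    (h : ∀ μ : Cardinal.{u}, #{y : X | #(f ⁻¹' {y}) = μ} = #{y : X | #(g ⁻¹' {y}) = μ}) :
    g ∈ M := by
  obtain ⟨σ, τ, hστ⟩ := exists_perm_of_mk_fibers_eq h
  have hσ : (⇑σ : Function.End X) ∈ M := hM σ.bijective
  have hτ : (⇑τ.symm : Function.End X) ∈ M := hM τ.symm.bijective
  have hg : g = (show Function.End X from ⇑σ) * f * (show Function.End X from ⇑τ.symm) := by
    funext x
    exact (congrArg (g : X → X) (τ.apply_symm_apply x)).symm.trans (congrFun hστ (τ.symm x))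
  rw [hg]
  exact M.mul_mem (M.mul_mem hσ hf) hτ

/-- The maps in `A'` have at most `κ ^< κ` kernel types, each coded by two small sets. -/
theorem exists_code_monA' {X : Type u} [Infinite X] :
    ∃ code : monA' X →
        {s : Set (X × X) // #s < #X} × {s : Set (X × X) // #s < #X},
      ∀ f g, code f = code g → ∀ μ : Cardinal.{u},
        #{y : X | #(f.1 ⁻¹' {y}) = μ} = #{y : X | #(g.1 ⁻¹' {y}) = μ} := by
  have hX : ℵ₀ ≤ #X := Cardinal.aleph0_le_mk X
  obtain ⟨e, he⟩ : ∃ e : Cardinal.{u} → X, Set.InjOn e (Set.Iic #X) := by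
    have h := mk_Iic_cardinal_le #X
    rw [Cardinal.add_one_eq hX] at h
    obtain ⟨e⟩ : Nonempty (Set.Iic #X ↪ X) := by
      rw [← Cardinal.lift_mk_le', Cardinal.lift_id'.{u, u + 1}]
      exact h
    classical
    refine ⟨fun μ => if h : μ ∈ Set.Iic #X then e ⟨μ, h⟩ else Classical.arbitrary X, ?_⟩
    intro a ha b hb hab
    simp only [dif_pos ha, dif_pos hb] at hab
    exact congrArg Subtype.val (e.injective hab)
  have hle : ∀ s : Set X, #s ∈ Set.Iic #X := fun s => Cardinal.mk_set_le s
  choose ξ hξ hbad using fun f : monA' X => f.2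
  let count : monA' X → Cardinal.{u} → Cardinal.{u} :=
    fun f μ => #{y : X | #(f.1 ⁻¹' {y}) = μ}
  let D₁ : monA' X → Set (X × X) := fun f => (fun μ => (e μ, e (count f μ))) '' Set.Iic (ξ f)
  let D₂ : monA' X → Set (X × X) :=
    fun f => (fun y => (y, e #(f.1 ⁻¹' {y}))) '' {y | ¬ #(f.1 ⁻¹' {y}) ≤ ξ f}
  have hD₁ : ∀ f, #(D₁ f) < #X := by
    intro f
    have h1 : Cardinal.lift.{u + 1} #(D₁ f) ≤ Cardinal.lift.{u} #(Set.Iic (ξ f)) :=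
      Cardinal.mk_image_le_lift
    have h2 := h1.trans (Cardinal.lift_le.2 (mk_Iic_cardinal_le (ξ f)))
    rw [Cardinal.lift_id'.{u, u + 1}, Cardinal.lift_le] at h2
    exact h2.trans_lt (Cardinal.add_one_lt_of_lt hX (hξ f))
  have hD₂ : ∀ f, #(D₂ f) < #X := fun f => Cardinal.mk_image_le.trans_lt (hbad f)
  have key : ∀ f g, D₁ f = D₁ g → ∀ μ ≤ ξ f, μ ≤ ξ g ∧ count f μ = count g μ := by
    intro f g h μ hμ
    have hm : (e μ, e (count f μ)) ∈ D₁ g := h ▸ ⟨μ, hμ, rfl⟩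
    obtain ⟨ν, hν, hνe⟩ := hm
    obtain ⟨h1, h2⟩ := Prod.mk.inj hνe
    obtain rfl : ν = μ := he (le_trans hν (hξ g).le) (le_trans hμ (hξ f).le) h1
    exact ⟨hν, (he (hle _) (hle _) h2).symm⟩
  have key₂ : ∀ f μ, μ ∈ Set.Iic #X → ¬ μ ≤ ξ f →
      {y : X | #(f.1 ⁻¹' {y}) = μ} = {y | (y, e μ) ∈ D₂ f} := by
    intro f μ hμX hμ
    ext y
    constructor
    · rintro rfl
      exact ⟨y, hμ, rfl⟩
    · rintro ⟨z, -, hz⟩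
      obtain ⟨h1, h2⟩ := Prod.mk.inj hz
      subst h1
      exact he (hle _) hμX h2
  refine ⟨fun f => (⟨D₁ f, hD₁ f⟩, ⟨D₂ f, hD₂ f⟩), fun f g h μ => ?_⟩
  have h₁ : D₁ f = D₁ g := congrArg (fun p => p.1.1) h
  have h₂ : D₂ f = D₂ g := congrArg (fun p => p.2.1) h
  by_cases hμ : μ ≤ ξ f
  · exact (key f g h₁ μ hμ).2
  have hμ' : ¬ μ ≤ ξ g := fun h' => hμ (key g f h₁.symm μ h').1
  by_cases hμX : μ ∈ Set.Iic #X
  · rw [key₂ f μ hμX hμ, key₂ g μ hμX hμ', h₂]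
  · have hempty : ∀ f : monA' X, {y : X | #(f.1 ⁻¹' {y}) = μ} = ∅ := fun f =>
      Set.eq_empty_of_forall_notMem fun y hy => hμX (hy ▸ hle _)
    rw [hempty f, hempty g]

theorem card_interval_S_A'_le (X : Type u) [Infinite X] :
    #{M : Submonoid (Function.End X) //
        permSubmonoid X ≤ M ∧ (M : Set (Function.End X)) ⊆ monA' X} ≤
      (2 : Cardinal.{u}) ^ (#X ^< #X) := by
  have hX : ℵ₀ ≤ #X := Cardinal.aleph0_le_mk X
  obtain ⟨code, hcode⟩ := exists_code_monA' (X := X)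
  have hle : #X ≤ #X ^< #X := by
    simpa using Cardinal.le_powerlt #X (Cardinal.one_lt_aleph0.trans_le hX)
  have hsub : ∀ M N : {M : Submonoid (Function.End X) //
      permSubmonoid X ≤ M ∧ (M : Set (Function.End X)) ⊆ monA' X},
      code '' {f | f.1 ∈ M.1} ⊆ code '' {f | f.1 ∈ N.1} → M.1 ≤ N.1 := by
    intro M N h f hf
    obtain ⟨g, hg, hgf⟩ := h ⟨⟨f, M.2.2 hf⟩, hf, rfl⟩
    exact mem_of_mk_fibers_eq N.2.1 hg (hcode _ _ hgf)
  have hinj : Function.Injective fun M : {M : Submonoid (Function.End X) //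
      permSubmonoid X ≤ M ∧ (M : Set (Function.End X)) ⊆ monA' X} =>
      code '' {f | f.1 ∈ M.1} := fun M N h =>
    Subtype.ext (le_antisymm (hsub M N h.subset) (hsub N M h.symm.subset))
  refine (Cardinal.mk_le_of_injective hinj).trans ?_
  rw [Cardinal.mk_set, ← Cardinal.mul_def]
  have hB : #{s : Set (X × X) // #s < #X} ≤ #X ^< #X :=
    mk_small_subsets_le hX (by simp)
  refine Cardinal.power_le_power_left two_ne_zero ((mul_le_mul' hB hB).trans_eq ?_)
  exact Cardinal.mul_eq_self (hX.trans hle)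

/-- The set of regular cardinals occurring as cardinalities of fibers of `f`. -/
def regularSpectrum {X : Type u} (f : X → X) : Set Cardinal.{u} :=
  {ρ | ρ.IsRegular ∧ ∃ y, #(f ⁻¹' {y}) = ρ}

theorem regularSpectrum_comp_subset {X : Type u} {f g : X → X} (hg : Function.Surjective g) :
    regularSpectrum (f ∘ g) ⊆ regularSpectrum f ∪ regularSpectrum g := by
  rintro ρ ⟨hρ, y, hy⟩
  have hle : #(f ⁻¹' {y}) ≤ ρ := by
    rw [← hy]
    refine Cardinal.mk_le_of_surjective (f := fun x => ⟨g x.1, x.2⟩) ?_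
    rintro ⟨z, hz⟩
    obtain ⟨x, rfl⟩ := hg z
    exact ⟨⟨x, hz⟩, rfl⟩
  rcases hle.eq_or_lt with h | h
  · exact Or.inl ⟨hρ, y, h⟩
  right
  have hU : (f ∘ g) ⁻¹' {y} = ⋃ x : f ⁻¹' {y}, g ⁻¹' {x.1} := by
    ext z
    simp
  have hx : ∃ x : f ⁻¹' {y}, ρ ≤ #(g ⁻¹' {x.1}) := by
    by_contra! hlt
    have := (Cardinal.card_iUnion_lt_iff_forall_of_isRegular
      (t := fun x : f ⁻¹' {y} => g ⁻¹' {x.1}) hρ h).2 hlt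
    rw [← hU, hy] at this
    exact lt_irrefl _ this
  obtain ⟨x, hx⟩ := hx
  refine ⟨hρ, x.1, le_antisymm ?_ hx⟩
  rw [← hy, hU]
  exact Cardinal.mk_le_mk_of_subset (Set.subset_iUnion (fun x : f ⁻¹' {y} => g ⁻¹' {x.1}) x)

theorem nontrivial_fibers_of_bijective {X : Type u} [Infinite X] {f : X → X}
    (hf : Function.Bijective f) :
    #{y : X | ¬ #(f ⁻¹' {y}) ≤ 1} < #X ∧ regularSpectrum f = ∅ := by
  have h1 : ∀ y, #(f ⁻¹' {y}) = 1 := by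
    intro y
    obtain ⟨x, rfl⟩ := hf.surjective y
    rw [← Set.image_singleton, Set.preimage_image_eq _ hf.injective, Cardinal.mk_singleton]
  constructor
  · have hempty : {y : X | ¬ #(f ⁻¹' {y}) ≤ 1} = ∅ :=
      Set.eq_empty_of_forall_notMem fun y hy => hy (h1 y).le
    rw [hempty, Cardinal.mk_eq_zero]
    exact Cardinal.aleph0_pos.trans_le (Cardinal.aleph0_le_mk X)
  · refine Set.eq_empty_of_forall_notMem ?_
    rintro ρ ⟨hρ, y, rfl⟩
    rw [h1] at hρ
    exact Cardinal.one_lt_aleph0.not_ge hρ.aleph0_le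

/-- The surjections with few nontrivial fibers whose regular spectrum lies in the ideal `I`. -/
def spectrumSubmonoid (X : Type u) [Infinite X] (I : Order.Ideal (Set Cardinal.{u})) :
    Submonoid (Function.End X) where
  carrier := {f | Function.Surjective f ∧ #{y : X | ¬ #(f ⁻¹' {y}) ≤ 1} < #X ∧
    regularSpectrum f ∈ I}
  mul_mem' := by
    rintro f g ⟨hf, hf', hfI⟩ ⟨hg, hg', hgI⟩
    refine ⟨hf.comp hg, ?_, I.lower (regularSpectrum_comp_subset hg) (I.sup_mem hfI hgI)⟩
    have hsub : {y : X | ¬ #((f ∘ g) ⁻¹' {y}) ≤ 1} ⊆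
        {y : X | ¬ #(f ⁻¹' {y}) ≤ 1} ∪ f '' {y : X | ¬ #(g ⁻¹' {y}) ≤ 1} := by
      intro y hy
      by_contra h
      obtain ⟨h1, h2⟩ := not_or.1 h
      replace h1 : #(f ⁻¹' {y}) ≤ 1 := not_not.1 h1
      refine hy (Cardinal.le_one_iff_subsingleton.2 ⟨?_⟩)
      rintro ⟨a, ha⟩ ⟨b, hb⟩
      rw [Cardinal.le_one_iff_subsingleton] at h1
      have hab : g a = g b :=
        congrArg Subtype.val (h1.elim (⟨g a, ha⟩ : f ⁻¹' {y}) ⟨g b, hb⟩)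
      have h3 : #(g ⁻¹' {g a}) ≤ 1 := not_not.1 fun h3 => h2 ⟨g a, h3, ha⟩
      rw [Cardinal.le_one_iff_subsingleton] at h3
      have hab' : a = b :=
        congrArg Subtype.val (h3.elim (⟨a, rfl⟩ : g ⁻¹' {g a}) ⟨b, hab.symm⟩)
      exact Subtype.ext hab'
    refine (Cardinal.mk_le_mk_of_subset hsub).trans_lt ((Cardinal.mk_union_le _ _).trans_lt ?_)
    exact Cardinal.add_lt_of_lt (Cardinal.aleph0_le_mk X) hf'
      (Cardinal.mk_image_le.trans_lt hg')
  one_mem' := by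
    obtain ⟨h1, h2⟩ := nontrivial_fibers_of_bijective (X := X) Function.bijective_id
    exact ⟨Function.surjective_id, h1, I.lower h2.le I.bot_mem⟩

theorem permSubmonoid_le_spectrumSubmonoid {X : Type u} [Infinite X]
    (I : Order.Ideal (Set Cardinal.{u})) : permSubmonoid X ≤ spectrumSubmonoid X I := by
  intro f hf
  obtain ⟨h1, h2⟩ := nontrivial_fibers_of_bijective hf
  exact ⟨hf.surjective, h1, I.lower h2.le I.bot_mem⟩

theorem spectrumSubmonoid_subset_monA' {X : Type u} [Infinite X]
    (I : Order.Ideal (Set Cardinal.{u})) :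
    (spectrumSubmonoid X I : Set (Function.End X)) ⊆ monA' X := fun _ hf =>
  ⟨1, Cardinal.one_lt_aleph0.trans_le (Cardinal.aleph0_le_mk X), hf.2.1⟩

/-- Prescribed fiber cardinalities are realized by a map all of whose other fibers are
singletons. -/
theorem exists_mk_fibers_eq {X K : Type u} [Infinite X] (c : K → Cardinal.{u}) (hK : #K ≤ #X)
    (hc : ∀ k, c k ≤ #X) :
    ∃ (f : X → X) (j : K → X), (∀ k, #(f ⁻¹' {j k}) = c k) ∧
      ∀ y ∉ Set.range j, #(f ⁻¹' {y}) = 1 := by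
  have hX : ℵ₀ ≤ #X := Cardinal.aleph0_le_mk X
  have hsum : #(Σ k : K, (c k).out) ≤ #X := by
    rw [Cardinal.mk_sigma]
    calc
      _ ≤ Cardinal.sum fun _ : K => #X := Cardinal.sum_le_sum _ _ fun k => by simpa using hc k
      _ = #K * #X := by simp
      _ ≤ #X * #X := by gcongr
      _ = #X := Cardinal.mul_eq_self hX
  obtain ⟨a⟩ : Nonempty (X ≃ (Σ k : K, (c k).out) ⊕ X) := by
    refine Cardinal.eq.1 ?_
    rw [Cardinal.mk_sum, Cardinal.lift_id, Cardinal.lift_id, Cardinal.add_eq_right hX hsum]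
  obtain ⟨b⟩ : Nonempty (K ⊕ X ≃ X) := by
    refine Cardinal.eq.1 ?_
    rw [Cardinal.mk_sum, Cardinal.lift_id, Cardinal.lift_id, Cardinal.add_eq_right hX hK]
  refine ⟨fun x => b (Sum.map Sigma.fst id (a x)), fun k => b (Sum.inl k), fun k => ?_,
    fun y hy => ?_⟩
  · have h : (fun x => b (Sum.map Sigma.fst id (a x))) ⁻¹' {b (Sum.inl k)} =
        Set.range fun o : (c k).out => a.symm (Sum.inl ⟨k, o⟩) := by
      ext x
      obtain ⟨p, rfl⟩ := a.symm.surjective x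
      rcases p with ⟨k', o⟩ | z
      · simp only [Set.mem_preimage, Equiv.apply_symm_apply, Sum.map_inl, Set.mem_singleton_iff,
          EmbeddingLike.apply_eq_iff_eq, Sum.inl.injEq, Set.mem_range]
        constructor
        · rintro rfl
          exact ⟨o, rfl⟩
        · rintro ⟨o', ho'⟩
          exact (congrArg Sigma.fst ho').symm
      · simp
    rw [h, Cardinal.mk_range_eq, Cardinal.mk_out]
    intro o o' ho
    simpa using ho
  · obtain ⟨k | z, rfl⟩ := b.surjective y
    · exact absurd ⟨k, rfl⟩ hy
    have h : (fun x => b (Sum.map Sigma.fst id (a x))) ⁻¹' {b (Sum.inr z)} =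
        {a.symm (Sum.inr z)} := by
      ext x
      obtain ⟨p, rfl⟩ := a.symm.surjective x
      rcases p with p | w <;> simp
    rw [h, Cardinal.mk_singleton]

/-- Every small set of regular cardinals `≤ #X` is the regular spectrum of a surjection with few
nontrivial fibers. -/
theorem exists_regularSpectrum_eq {X K : Type u} [Infinite X] (c : K → Cardinal.{u})
    (hK : #K < #X) (hc : ∀ k, c k ≤ #X) (hreg : ∀ k, (c k).IsRegular) :
    ∃ f : X → X, Function.Surjective f ∧ #{y : X | ¬ #(f ⁻¹' {y}) ≤ 1} < #X ∧
      regularSpectrum f = Set.range c := by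
  obtain ⟨f, j, hj, hf⟩ := exists_mk_fibers_eq c hK.le hc
  refine ⟨f, fun y => ?_, ?_, ?_⟩
  · have : #(f ⁻¹' {y}) ≠ 0 := by
      by_cases hy : y ∈ Set.range j
      · obtain ⟨k, rfl⟩ := hy
        rw [hj]
        exact (hreg k).pos.ne'
      · rw [hf y hy]
        exact one_ne_zero
    obtain ⟨⟨x, hx⟩⟩ := Cardinal.mk_ne_zero_iff.1 this
    exact ⟨x, hx⟩
  · refine (Cardinal.mk_le_mk_of_subset (t := Set.range j) ?_).trans_lt
      (Cardinal.mk_range_le.trans_lt hK)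
    intro y hy
    by_contra h
    exact hy (hf y h).le
  · ext ρ
    constructor
    · rintro ⟨hρ, y, rfl⟩
      by_cases hy : y ∈ Set.range j
      · obtain ⟨k, rfl⟩ := hy
        exact ⟨k, (hj k).symm⟩
      · rw [hf y hy] at hρ
        exact absurd hρ.aleph0_le Cardinal.one_lt_aleph0.not_ge
    · rintro ⟨k, rfl⟩
      exact ⟨hreg k, j k, hj k⟩

/-- The ideal of sets covered by finitely many members of a family. -/
def coverIdeal {α J : Type*} (A : J → Set α) : Order.Ideal (Set α) where
  carrier := {T | ∃ s : Finset J, T ⊆ ⋃ i ∈ s, A i}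
  lower' := fun _ _ hTU ⟨s, hs⟩ => ⟨s, hTU.trans hs⟩
  nonempty' := ⟨∅, ∅, by simp⟩
  directed' := by
    classical
    rintro T ⟨s, hs⟩ U ⟨t, ht⟩
    refine ⟨T ∪ U, ⟨s ∪ t, ?_⟩, Set.subset_union_left, Set.subset_union_right⟩
    rw [Finset.set_biUnion_union]
    exact Set.union_subset_union hs ht

/-- An antichain of small sets yields pairwise distinct submonoids indexed by its subsets. -/
theorem two_power_mk_antichain_le {X V J : Type u} [Infinite X] (hX : ℵ₀ < #X)
    (c : Finset V → Cardinal.{u}) (hcinj : Function.Injective c) (hc : ∀ F, c F ≤ #X)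
    (hreg : ∀ F, (c F).IsRegular) (D : J → Set V) (hD : ∀ i, #(D i) < #X)
    (hanti : ∀ i j, D i ⊆ D j → i = j) :
    (2 : Cardinal.{u}) ^ #J ≤ #{M : Submonoid (Function.End X) //
        permSubmonoid X ≤ M ∧ (M : Set (Function.End X)) ⊆ monA' X} := by
  classical
  let A : J → Set Cardinal.{u} := fun i => c '' {F | (F : Set V) ⊆ D i}
  have hfam : ∀ i, ∃ f : X → X, Function.Surjective f ∧ #{y : X | ¬ #(f ⁻¹' {y}) ≤ 1} < #X ∧
      regularSpectrum f = A i := by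
    intro i
    have hsmall : #{F : Finset V | (F : Set V) ⊆ D i} < #X := by
      have h1 : #{F : Finset V | (F : Set V) ⊆ D i} ≤ #(Finset (D i)) := by
        refine Cardinal.mk_le_of_surjective
          (f := fun G : Finset (D i) => ⟨G.map (Function.Embedding.subtype _), ?_⟩) ?_
        · intro v hv
          simp only [Finset.coe_map, Set.mem_image] at hv
          obtain ⟨w, -, rfl⟩ := hv
          exact w.2
        · rintro ⟨F, hF⟩
          refine ⟨F.subtype (· ∈ D i), Subtype.ext ?_⟩
          exact Finset.subtype_map_of_mem fun v hv => hF hv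
      refine h1.trans_lt ?_
      rcases finite_or_infinite (D i) with h | h
      · exact Cardinal.mk_le_aleph0.trans_lt hX
      · rw [Cardinal.mk_finset_of_infinite]
        exact hD i
    obtain ⟨f, h1, h2, h3⟩ := exists_regularSpectrum_eq
      (fun F : {F : Finset V | (F : Set V) ⊆ D i} => c F.1) hsmall (fun F => hc _)
      (fun F => hreg _)
    refine ⟨f, h1, h2, h3.trans ?_⟩
    ext ρ
    simp [A]
  choose f hf₁ hf₂ hf₃ using hfam
  let N : Set J → Submonoid (Function.End X) := fun 𝒜 =>
    spectrumSubmonoid X (coverIdeal fun i : 𝒜 => A i)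
  have hmem : ∀ 𝒜 i, (f i : Function.End X) ∈ N 𝒜 ↔ i ∈ 𝒜 := by
    intro 𝒜 i
    constructor
    · rintro ⟨-, -, s, hs⟩
      rw [hf₃] at hs
      by_contra hi
      have hne : ∀ j : 𝒜, ∃ v ∈ D i, v ∉ D j := by
        intro j
        rw [← Set.not_subset]
        intro h
        exact hi (hanti _ _ h ▸ j.2)
      choose v hvi hvj using hne
      have hF : c (s.image v) ∈ A i := by
        refine ⟨s.image v, ?_, rfl⟩
        intro w hw
        simp only [Finset.coe_image, Set.mem_image] at hw
        obtain ⟨j, -, rfl⟩ := hw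
        exact hvi j
      obtain ⟨j, hj, G, hG, hGe⟩ := by simpa only [Set.mem_iUnion, exists_prop] using hs hF
      rw [hcinj hGe] at hG
      exact hvj j (hG (Finset.mem_coe.2 (Finset.mem_image_of_mem v hj)))
    · intro hi
      refine ⟨hf₁ i, hf₂ i, {⟨i, hi⟩}, ?_⟩
      rw [hf₃]
      simp
  rw [← Cardinal.mk_set]
  refine Cardinal.mk_le_of_injective (f := fun 𝒜 =>
    ⟨N 𝒜, permSubmonoid_le_spectrumSubmonoid _, spectrumSubmonoid_subset_monA' _⟩) ?_
  intro 𝒜 ℬ h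
  have hN : N 𝒜 = N ℬ := congrArg Subtype.val h
  ext i
  rw [← hmem 𝒜, hN, hmem]

theorem two_power_powerlt_le_card_interval_S_A' {X : Type u} [Infinite X] (hX : ℵ₀ < #X)
    (c : X → Cardinal.{u}) (hcinj : Function.Injective c) (hc : ∀ x, c x ≤ #X)
    (hreg : ∀ x, (c x).IsRegular) :
    (2 : Cardinal.{u}) ^ (#X ^< #X) ≤ #{M : Submonoid (Function.End X) //
        permSubmonoid X ≤ M ∧ (M : Set (Function.End X)) ⊆ monA' X} := by
  let W := (#X).ord.ToType
  have hW : #W = #X := Cardinal.mk_ord_toType _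
  let V := (W × W) × X
  have hV : #V = #X := by simp [V, hW, Cardinal.mul_eq_self hX.le]
  have hVinf : Infinite V := Cardinal.infinite_iff.2 (hV ▸ hX.le)
  obtain ⟨e⟩ : Nonempty (Finset V ≃ X) :=
    Cardinal.eq.1 ((Cardinal.mk_finset_of_infinite V).trans hV)
  let D : (Σ i : W, (Set.Iic i → X)) → Set V :=
    fun p => Set.range fun x : Set.Iic p.1 => ((p.1, x.1), p.2 x)
  have hJ : #X ^< #X ≤ #(Σ i : W, (Set.Iic i → X)) := by
    rw [Cardinal.powerlt_le]
    intro d hd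
    obtain ⟨i, hi⟩ := exists_mk_Iio_toType_eq hd
    calc
      #X ^ d ≤ #X ^ #(Set.Iic i) := by
        refine Cardinal.power_le_power_left (Cardinal.mk_ne_zero X) ?_
        rw [← hi]
        exact Cardinal.mk_le_mk_of_subset Set.Iio_subset_Iic_self
      _ = #(Set.Iic i → X) := by simp
      _ ≤ _ := Cardinal.mk_le_of_injective (f := fun g => Sigma.mk i g)
        (sigma_mk_injective (β := fun i : W => Set.Iic i → X))
  refine (Cardinal.power_le_power_left two_ne_zero hJ).trans ?_
  refine two_power_mk_antichain_le hX (c ∘ e) (hcinj.comp e.injective) (fun F => hc _)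
    (fun F => hreg _) D (fun p => Cardinal.mk_range_le.trans_lt (mk_Iic_toType_lt hX.le _)) ?_
  rintro ⟨i, g⟩ ⟨j, h⟩ hsub
  have key : ∀ x : Set.Iic i, ∃ y : Set.Iic j, ((j, y.1), h y) = ((i, x.1), g x) :=
    fun x => hsub ⟨x, rfl⟩
  obtain ⟨y, hy⟩ := key ⟨i, Set.mem_Iic.2 le_rfl⟩
  obtain rfl : j = i := congrArg (fun v : V => v.1.1) hy
  congr 1
  funext x
  obtain ⟨y, hy⟩ := key x
  obtain rfl : y = x := Subtype.ext (congrArg (fun v : V => v.1.2) hy)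
  exact (congrArg Prod.snd hy).symm

/-- On an infinite set of singular cardinality `κ = ℵ_α` with `λ = max(|α|, ℵ₀) = κ`,
the interval `[S, A']` has cardinality `2^(κ^{<κ})`. -/
theorem card_interval_S_A'_singular_large_lambda {X : Type u} [Infinite X] {α : Ordinal.{u}}
    {κ : Cardinal.{u}} (hκ : #X = κ) (hκα : κ = Cardinal.aleph α) (hsing : ¬κ.IsRegular)
    (hlam : max α.card ℵ₀ = κ) :
    #{M : Submonoid (Function.End X) //
        permSubmonoid X ≤ M ∧ (M : Set (Function.End X)) ⊆ monA' X} =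
      (2 : Cardinal.{u}) ^ (κ ^< κ) := by
  have hX : ℵ₀ < κ := (hκ ▸ Cardinal.aleph0_le_mk X).lt_of_ne fun h =>
    hsing (h ▸ Cardinal.isRegular_aleph0)
  have hα : α.card = κ := by
    rcases max_choice α.card ℵ₀ with h | h
    · exact h.symm.trans hlam
    · exact absurd (h.symm.trans hlam) hX.ne
  subst hκ
  refine le_antisymm (card_interval_S_A'_le X) ?_
  obtain ⟨e⟩ : Nonempty (X ≃ α.ToType) := Cardinal.eq.1 (by simp [hα])
  refine two_power_powerlt_le_card_interval_S_A' hX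
    (fun x => Order.succ (Cardinal.aleph (Ordinal.ToType.toOrd (e x)).1)) ?_ (fun x => ?_)
    (fun x => Cardinal.isRegular_succ (Cardinal.aleph0_le_aleph _))
  · intro x y hxy
    have h := Cardinal.aleph.injective (Order.succ_injective hxy)
    exact e.injective (Ordinal.ToType.mk.symm.injective (Subtype.ext h))
  · rw [hκα]
    exact Order.succ_le_of_lt (Cardinal.aleph_lt_aleph.2 (Ordinal.ToType.toOrd (e x)).2)
end

section
/- Let X be an infinite set of singular cardinality κ = ℵ_α with λ = max(|α|, ℵ₀) = κ, and let D be the intersection of all precomplete submonoids of O^(1) containing the permutations. Then the interval [S, D] has cardinality 2^(κ^{<κ}), where κ^{<κ} = sup{κ^ξ : ξ a cardinal, ξ < κ}. -/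
open Cardinal

universe u

/-- A family of sets each at least as large as its index type has an injective choice function. -/
theorem exists_injective_choice {ι Y : Type u} (K : ι → Set Y) (hK : ∀ i, #ι ≤ #(K i)) :
    ∃ ψ : ι → Y, Function.Injective ψ ∧ ∀ i, ψ i ∈ K i := by
  obtain ⟨r, hr, hord⟩ := Cardinal.exists_ord_eq ι
  have key : ∀ (i : ι) (g : ∀ j, r j i → Y), ∃ y ∈ K i, ∀ j h, g j h ≠ y := by
    intro i g
    by_contra! hcon
    have hsub : K i ⊆ Set.range fun p : {j // r j i} => g p.1 p.2 := fun y hy => by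
      obtain ⟨j, h, e⟩ := hcon y hy
      exact ⟨⟨j, h⟩, e⟩
    have h1 : #(K i) ≤ #{j // r j i} := (mk_le_mk_of_subset hsub).trans mk_range_le
    have h2 : #{j // r j i} < #ι := Cardinal.card_typein_lt i hord
    exact absurd ((hK i).trans h1) (not_le.2 h2)
  let F : ∀ i : ι, (∀ j, r j i → Y) → Y := fun i g => (key i g).choose
  have hwf : WellFounded r := hr.wf
  let ψ : ι → Y := hwf.fix F
  have hψ : ∀ i, ψ i = F i fun j _ => ψ j := fun i => hwf.fix_eq F i
  have hne : ∀ i j, r j i → ψ j ≠ ψ i := fun i j h => by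
    rw [hψ i]
    exact (key i fun j _ => ψ j).choose_spec.2 j h
  refine ⟨ψ, fun i j hij => ?_, fun i => ?_⟩
  · rcases trichotomous_of r i j with h | h | h
    · exact absurd hij (hne _ _ h)
    · exact h
    · exact absurd hij.symm (hne _ _ h)
  · rw [hψ i]
    exact (key i fun j _ => ψ j).choose_spec.1

/-- Two injections with equinumerous range complements differ by a permutation. -/
theorem exists_perm_comp_eq {X : Type u} {f g : X → X} (hf : Function.Injective f)
    (hg : Function.Injective g) (h : #((Set.range f)ᶜ : Set X) = #((Set.range g)ᶜ : Set X)) :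
    ∃ s : Equiv.Perm X, ∀ x, s (f x) = g x := by
  let e : Set.range f ↪ X := (Equiv.ofInjective f hf).symm.toEmbedding.trans ⟨g, hg⟩
  have he : Set.range e = Set.range g := by
    ext y
    constructor
    · rintro ⟨x, rfl⟩
      exact ⟨_, rfl⟩
    · rintro ⟨x, rfl⟩
      exact ⟨Equiv.ofInjective f hf x, by simp [e]⟩
  obtain ⟨s, hs⟩ := Cardinal.extend_function e (by rw [he]; exact Cardinal.eq.1 h)
  refine ⟨s, fun x => ?_⟩
  simpa [e] using hs ⟨f x, x, rfl⟩

theorem perm_mem {X : Type u} {C : Submonoid (Function.End X)} (hC : permSubmonoid X ≤ C)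
    (s : Equiv.Perm X) : (s : X → X) ∈ C :=
  hC (show Function.Bijective s from s.bijective)

theorem comp_mem {X : Type u} {C : Submonoid (Function.End X)} {f g : X → X} (hf : f ∈ C)
    (hg : g ∈ C) : f ∘ g ∈ C :=
  C.mul_mem hf hg

/-- The well-ordered type of a singular cardinal has a small cofinal subset. -/
theorem exists_small_cofinal {κ : Cardinal.{u}} (h0 : ℵ₀ ≤ κ) (hsing : ¬κ.IsRegular) :
    ∃ W : Set κ.ord.ToType, #W < κ ∧ ∀ x, ∃ w ∈ W, x ≤ w := by
  obtain ⟨W, hW, hc⟩ := Order.exists_cof_eq κ.ord.ToType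
  refine ⟨W, ?_, hW⟩
  rw [hc, Ordinal.cof_toType]
  by_contra! h
  exact hsing ⟨h0, h⟩

theorem mk_Iio_toType {o : Ordinal.{u}} (x : o.ToType) : #(Set.Iio x) = x.toOrd.1.card :=
  Ordinal.card_typein (r := (· < ·)) x

theorem mk_Iio_toType_lt {κ : Cardinal.{u}} (x : κ.ord.ToType) : #(Set.Iio x) < κ := by
  simpa using mk_Iio_lt x (by simp)

theorem mk_Iic_lt_of_infinite {κ : Cardinal.{u}} (h0 : ℵ₀ ≤ κ) (x : κ.ord.ToType) :
    #(Set.Iic x) < κ := by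
  have h2 : Set.Iic x ⊆ Set.Iio x ∪ {x} := fun y hy => by
    rcases (show y ≤ x from hy).lt_or_eq with h | h
    · exact Or.inl h
    · exact Or.inr h
  refine ((mk_le_mk_of_subset h2).trans (mk_union_le _ _)).trans_lt
    (add_lt_of_lt h0 (mk_Iio_toType_lt x) ?_)
  rw [mk_singleton]
  exact one_lt_aleph0.trans_le h0

/-- A set of singular cardinality is a small disjoint union of small sets. -/
theorem exists_small_partition {X : Type u} [Infinite X] (hsing : ¬(#X).IsRegular) :
    ∃ χ : X → X, #(Set.range χ) < #X ∧ ∀ y, #(χ ⁻¹' {y}) < #X := by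
  have h0 := aleph0_le_mk X
  obtain ⟨W, hW, hcof⟩ := exists_small_cofinal h0 hsing
  choose c hcW hc using hcof
  obtain ⟨e⟩ : Nonempty (X ≃ (#X).ord.ToType) := Cardinal.eq.1 (mk_ord_toType #X).symm
  refine ⟨fun x => e.symm (c (e x)), ?_, fun y => ?_⟩
  · have : Set.range (fun x => e.symm (c (e x))) ⊆ e.symm '' W := by
      rintro _ ⟨x, rfl⟩
      exact ⟨_, hcW _, rfl⟩
    exact ((mk_le_mk_of_subset this).trans mk_image_le).trans_lt hW
  · have : (fun x => e.symm (c (e x))) ⁻¹' {y} ⊆ e.symm '' Set.Iic (e y) := by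
      rintro x hx
      have hx' : e.symm (c (e x)) = y := hx
      refine ⟨e x, ?_, by simp⟩
      rw [← hx']
      simpa using hc (e x)
    exact ((mk_le_mk_of_subset this).trans mk_image_le).trans_lt (mk_Iic_lt_of_infinite h0 _)

/-- A union of at most `a` sets, each of size at most `b`, has size at most `a * b`. -/
theorem mk_preimage_le_mul {X Y : Type u} (g : X → Y) (s : Set Y) {b : Cardinal.{u}}
    (hb : ∀ y ∈ s, #(g ⁻¹' {y}) ≤ b) : #(g ⁻¹' s) ≤ #s * b := by
  have h : g ⁻¹' s ⊆ ⋃ y : s, g ⁻¹' {(y : Y)} := fun x hx => Set.mem_iUnion.2 ⟨⟨g x, hx⟩, rfl⟩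
  refine (mk_le_mk_of_subset h).trans ((mk_iUnion_le_sum_mk).trans ?_)
  calc Cardinal.sum (fun y : s => #(g ⁻¹' {(y : Y)})) ≤ Cardinal.sum (fun _ : s => b) :=
        sum_le_sum _ _ fun y => hb y y.2
    _ = #s * b := by simp

theorem monA'_comp {X : Type u} [Infinite X] {f g : X → X} (hf : f ∈ monA' X) (hg : g ∈ monA' X) :
    f ∘ g ∈ monA' X := by
  obtain ⟨ξ, hξ, hf⟩ := hf
  obtain ⟨η, hη, hg⟩ := hg
  have h0 := aleph0_le_mk X
  refine ⟨ξ * η, mul_lt_of_lt h0 hξ hη, ?_⟩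
  have hsub : {x : X | ¬ #((f ∘ g) ⁻¹' {x}) ≤ ξ * η} ⊆
      {x : X | ¬ #(f ⁻¹' {x}) ≤ ξ} ∪ f '' {x : X | ¬ #(g ⁻¹' {x}) ≤ η} := by
    intro x hx
    by_contra hcon
    simp only [Set.mem_union, not_or] at hcon
    obtain ⟨h1, h2⟩ := hcon
    have h1' : #(f ⁻¹' {x}) ≤ ξ := not_not.1 h1
    refine hx ?_
    rw [Set.preimage_comp]
    refine (mk_preimage_le_mul g _ (b := η) fun y hy => ?_).trans (mul_le_mul' h1' le_rfl)
    by_contra h3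
    exact h2 ⟨y, h3, hy⟩
  refine ((mk_le_mk_of_subset hsub).trans (mk_union_le _ _)).trans_lt (add_lt_of_lt h0 hf ?_)
  exact mk_image_le.trans_lt hg

theorem mem_monA'_of_fiber_le {X : Type u} [Infinite X] {f : X → X} {ξ : Cardinal.{u}}
    (hξ : ξ < #X) (h : ∀ x, #(f ⁻¹' {x}) ≤ ξ) : f ∈ monA' X := by
  refine ⟨ξ, hξ, ?_⟩
  have : IsEmpty {x : X | ¬ #(f ⁻¹' {x}) ≤ ξ} := ⟨fun x => x.2 (h x)⟩
  rw [Cardinal.mk_eq_zero]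
  exact aleph0_pos.trans_le (aleph0_le_mk X)

theorem mem_monA'_of_injective {X : Type u} [Infinite X] {f : X → X}
    (h : Function.Injective f) : f ∈ monA' X := by
  refine mem_monA'_of_fiber_le (one_lt_aleph0.trans_le (aleph0_le_mk X)) fun x => ?_
  rw [Cardinal.le_one_iff_subsingleton]
  exact ⟨fun a b => Subtype.ext (h (a.2.trans b.2.symm))⟩

/-- The set `A'` as a submonoid of the full transformation monoid. -/
def monA'Submonoid (X : Type u) [Infinite X] : Submonoid (Function.End X) where
  carrier := monA' X
  mul_mem' hf hg := monA'_comp hf hg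
  one_mem' := mem_monA'_of_injective (f := (id : X → X)) Function.injective_id

theorem permSubmonoid_le_monA' (X : Type u) [Infinite X] : permSubmonoid X ≤ monA'Submonoid X :=
  fun f hf => mem_monA'_of_injective (f := f) (show Function.Bijective f from hf).1

theorem exists_projection (X : Type u) [Infinite X] :
    ∃ p : X → X, ∀ y, #(p ⁻¹' {y}) = #X := by
  obtain ⟨e⟩ : Nonempty (X × X ≃ X) := Cardinal.eq.1 (by simp)
  refine ⟨fun x => (e.symm x).1, fun y => ?_⟩
  refine Cardinal.mk_congr ⟨fun x => (e.symm x).2, fun z => ⟨e (y, z), by simp⟩, ?_, ?_⟩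
  · rintro ⟨x, hx⟩
    have hx' : (e.symm x).1 = y := hx
    simp [← hx']
  · intro z
    simp

theorem monA'Submonoid_ne_top (X : Type u) [Infinite X] : monA'Submonoid X ≠ ⊤ := by
  intro h
  obtain ⟨p, hp⟩ := exists_projection X
  have : p ∈ monA'Submonoid X := h.ge (Submonoid.mem_top (show Function.End X from p))
  obtain ⟨ξ, hξ, hlt⟩ := this
  have hu : {x : X | ¬ #(p ⁻¹' {x}) ≤ ξ} = Set.univ :=
    Set.eq_univ_of_forall fun x => by
      change ¬ #(p ⁻¹' {x}) ≤ ξ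
      rw [hp x]
      exact not_le.2 hξ
  rw [hu, mk_univ] at hlt
  exact lt_irrefl _ hlt

/-- The doubling map: all fibers have two elements, and it has a co-large section. -/
theorem exists_doubling (X : Type u) [Infinite X] :
    ∃ (c σ τ : X → X), (∀ y, #(c ⁻¹' {y}) ≤ 2) ∧ (∀ y, c (σ y) = y) ∧
      Function.Injective σ ∧ Function.Injective τ ∧ (∀ x y, σ x ≠ τ y) := by
  obtain ⟨e⟩ : Nonempty (X ⊕ X ≃ X) := Cardinal.eq.1 (by simp)
  refine ⟨fun x => Sum.elim id id (e.symm x), fun y => e (Sum.inl y), fun y => e (Sum.inr y),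
    fun y => ?_, by simp, fun a b h => by simpa using h, fun a b h => by simpa using h, by simp⟩
  have hsub : (fun x => Sum.elim id id (e.symm x)) ⁻¹' {y} ⊆ {e (Sum.inl y), e (Sum.inr y)} := by
    intro x hx
    have hx' : Sum.elim id id (e.symm x) = y := hx
    rcases h : e.symm x with z | z
    · left
      rw [h] at hx'
      rw [← hx', ← e.apply_symm_apply x, h]
      rfl
    · right
      rw [h] at hx'
      rw [Set.mem_singleton_iff, ← hx', ← e.apply_symm_apply x, h]
      rfl
  refine (mk_le_mk_of_subset hsub).trans ((mk_insert_le).trans ?_)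
  rw [mk_singleton, one_add_one_eq_two]

theorem mk_compl_range_eq {X : Type u} {f g : X → X} (hg : Function.Injective g)
    (h : ∀ x y, f x ≠ g y) : #((Set.range f)ᶜ : Set X) = #X := by
  refine le_antisymm (mk_set_le _) ?_
  rw [← mk_range_eq g hg]
  refine mk_le_mk_of_subset ?_
  rintro _ ⟨y, rfl⟩ ⟨x, hx⟩
  exact h x y hx

/-- The generation criterion: for singular `#X`, permutations, a co-large injection, a map
which is surjective on a co-large set and a function outside `A'` generate everything. -/
theorem eq_top_of_generators {X : Type u} [Infinite X] (hsing : ¬(#X).IsRegular)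
    {C : Submonoid (Function.End X)} (hC : permSubmonoid X ≤ C)
    {j₀ : X → X} (hj₀ : j₀ ∈ C) (hj₀i : Function.Injective j₀)
    (hj₀r : #((Set.range j₀)ᶜ : Set X) = #X)
    {c₀ σ : X → X} (hc₀ : c₀ ∈ C) (hσ : ∀ y, c₀ (σ y) = y)
    (hσr : #((Set.range σ)ᶜ : Set X) = #X)
    {c : X → X} (hc : c ∈ C) (hcA : c ∉ monA' X) : C = ⊤ := by
  have hσi : Function.Injective σ := fun a b h => by rw [← hσ a, h, hσ b]
  have hinj : ∀ j : X → X, Function.Injective j → #((Set.range j)ᶜ : Set X) = #X → j ∈ C := by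
    intro j hj hjr
    obtain ⟨s, hs⟩ := exists_perm_comp_eq hj₀i hj (hj₀r.trans hjr.symm)
    have : j = s ∘ j₀ := funext fun x => (hs x).symm
    rw [this]
    exact comp_mem (perm_mem hC s) hj₀
  have hlarge : ∀ ξ < #X, #X ≤ #{x : X | ¬ #(c ⁻¹' {x}) ≤ ξ} := by
    intro ξ hξ
    exact not_lt.1 fun h => hcA ⟨ξ, hξ, h⟩
  have hsmall : ∀ p : X → X, (∀ y, #(p ⁻¹' {y}) < #X) → p ∈ C := by
    intro p hp
    obtain ⟨ψ, hψi, hψ⟩ := exists_injective_choice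
      (fun i : X ⊕ X => {x : X | ¬ #(c ⁻¹' {x}) ≤ Sum.elim (fun y => #(p ⁻¹' {y})) (fun _ => 0) i})
      (by
        intro i
        have hX : #(X ⊕ X) = #X := by simp
        rw [hX]
        apply hlarge
        rcases i with y | y
        · exact hp y
        · exact aleph0_pos.trans_le (aleph0_le_mk X))
    have hE : ∀ y, Nonempty (p ⁻¹' {y} ↪ c ⁻¹' {ψ (Sum.inl y)}) := fun y =>
      (not_le.1 (hψ (Sum.inl y))).le
    let E := fun y => (hE y).some
    have hne : ∀ y, ∃ x, c x = ψ (Sum.inr y) := fun y => by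
      have h1 : 0 < #(c ⁻¹' {ψ (Sum.inr y)}) := not_le.1 (hψ (Sum.inr y))
      obtain ⟨⟨x, hx⟩⟩ := Cardinal.mk_ne_zero_iff.1 h1.ne'
      exact ⟨x, hx⟩
    choose t ht using hne
    let j : X → X := fun x => (E (p x) ⟨x, rfl⟩ : X)
    have hcj : ∀ x, c (j x) = ψ (Sum.inl (p x)) := fun x => (E (p x) ⟨x, rfl⟩).2
    have hEinj : ∀ y (a b : p ⁻¹' {y}), (E y a : X) = E y b → (a : X) = b := fun y a b h =>
      congrArg Subtype.val ((E y).injective (Subtype.ext h))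
    have hji : Function.Injective j := by
      intro a b h
      have h1 : p a = p b := by
        have := congrArg c h
        rw [hcj, hcj] at this
        exact Sum.inl_injective (hψi this)
      have h2 : ∀ y (ha : p a = y) (hb : p b = y), (E y ⟨a, ha⟩ : X) = E y ⟨b, hb⟩ → a = b :=
        fun y ha hb => hEinj y _ _
      have h3 : ∀ y (hb : p b = y), (E y ⟨b, hb⟩ : X) = j b := by
        rintro _ rfl
        rfl
      exact h2 (p a) rfl h1.symm (h.trans (h3 _ _).symm)
    have hti : Function.Injective t := fun a b h => by
      have := congrArg c h
      rw [ht, ht] at this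
      exact Sum.inr_injective (hψi this)
    have hjC : j ∈ C := by
      refine hinj j hji (mk_compl_range_eq hti fun x y h => ?_)
      have := congrArg c h
      rw [hcj, ht] at this
      exact Sum.inl_ne_inr (hψi this)
    obtain ⟨s, hs⟩ := exists_perm_comp_eq (f := ψ ∘ Sum.inl) (g := σ)
      (hψi.comp Sum.inl_injective) hσi
      ((mk_compl_range_eq (g := ψ ∘ Sum.inr) (hψi.comp Sum.inr_injective) fun x y h =>
        Sum.inl_ne_inr (hψi h)).trans hσr.symm)
    have hpe : p = c₀ ∘ s ∘ c ∘ j := by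
      funext x
      have := hs (p x)
      simp only [Function.comp_apply] at this ⊢
      rw [hcj, this, hσ]
    rw [hpe]
    exact comp_mem hc₀ (comp_mem (perm_mem hC s) (comp_mem hc hjC))
  rw [eq_top_iff]
  intro g _
  obtain ⟨χ, hχ, hχf⟩ := exists_small_partition hsing
  obtain ⟨e⟩ : Nonempty (X × X ≃ X) := Cardinal.eq.1 (by simp)
  classical
  let p₁ : X → X := fun z => if (e.symm z).2 ∈ Set.range χ then (e.symm z).1 else z
  let p₂ : X → X := fun x => e ((show X → X from g) x, χ x)
  have hg : g = (p₁ ∘ p₂ : X → X) := by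
    funext x
    simp only [Function.comp_apply, p₁, p₂, Equiv.symm_apply_apply]
    rw [if_pos ⟨x, rfl⟩]
  rw [hg]
  refine comp_mem (hsmall p₁ fun y => ?_) (hsmall p₂ fun y => ?_)
  · have hsub : p₁ ⁻¹' {y} ⊆ (fun u => e (y, u)) '' Set.range χ ∪ {y} := by
      intro z hz
      have hz' : p₁ z = y := hz
      by_cases h : (e.symm z).2 ∈ Set.range χ
      · left
        refine ⟨_, h, ?_⟩
        simp only [p₁, if_pos h] at hz'
        simp [← hz']
      · right
        simp only [p₁, if_neg h] at hz'
        exact hz'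
    refine ((mk_le_mk_of_subset hsub).trans (mk_union_le _ _)).trans_lt
      (add_lt_of_lt (aleph0_le_mk X) (mk_image_le.trans_lt hχ) ?_)
    rw [mk_singleton]
    exact one_lt_aleph0.trans_le (aleph0_le_mk X)
  · refine (mk_le_mk_of_subset fun x hx => ?_).trans_lt (hχf (e.symm y).2)
    have hx' : p₂ x = y := hx
    simp [← hx', p₂]

/-- Every member of the monoid generated by `C` and `f` is in `C`, or factors through `f`
with outer, respectively inner, factor in `C`. -/
theorem mem_closure_union_singleton {X : Type u} {C : Submonoid (Function.End X)}
    {f g : Function.End X} (hg : g ∈ Submonoid.closure ((C : Set (Function.End X)) ∪ {f})) :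
    g ∈ C ∨ ((∃ c ∈ C, ∃ t, g = c * (f * t)) ∧ ∃ c ∈ C, ∃ t, g = t * (f * c)) := by
  induction hg using Submonoid.closure_induction with
  | mem x hx =>
    rcases hx with hx | hx
    · exact Or.inl hx
    · rw [Set.mem_singleton_iff] at hx
      subst hx
      exact Or.inr ⟨⟨1, C.one_mem, 1, by simp⟩, ⟨1, C.one_mem, 1, by simp⟩⟩
  | one => exact Or.inl C.one_mem
  | mul x y _ _ hx hy =>
    rcases hx with hx | ⟨⟨c, hc, t, h1⟩, ⟨c', hc', t', h2⟩⟩ <;>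
      rcases hy with hy | ⟨⟨d, hd, r, h3⟩, ⟨d', hd', r', h4⟩⟩
    · exact Or.inl (C.mul_mem hx hy)
    · refine Or.inr ⟨⟨x * d, C.mul_mem hx hd, r, ?_⟩, ⟨d', hd', x * r', ?_⟩⟩
      · rw [h3, mul_assoc]
      · rw [h4, mul_assoc]
    · refine Or.inr ⟨⟨c, hc, t * y, ?_⟩, ⟨c' * y, C.mul_mem hc' hy, t', ?_⟩⟩
      · rw [h1]; simp only [mul_assoc]
      · rw [h2]; simp only [mul_assoc]
    · refine Or.inr ⟨⟨c, hc, t * y, ?_⟩, ⟨d', hd', x * r', ?_⟩⟩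
      · rw [h1]; simp only [mul_assoc]
      · rw [h4]; simp only [mul_assoc]

theorem precomplete_monA' {X : Type u} [Infinite X] (hsing : ¬(#X).IsRegular) :
    Precomplete (monA'Submonoid X) := by
  refine ⟨monA'Submonoid_ne_top X, fun f hf => ?_⟩
  obtain ⟨c, σ, τ, hc, hσ, hσi, hτi, hne⟩ := exists_doubling X
  have hle : monA'Submonoid X ≤
      Submonoid.closure ((monA'Submonoid X : Set (Function.End X)) ∪ {f}) :=
    fun g hg => Submonoid.subset_closure (Or.inl hg)
  have hcr := mk_compl_range_eq hτi hne
  refine eq_top_of_generators hsing ((permSubmonoid_le_monA' X).trans hle)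
    (hle (mem_monA'_of_injective hσi)) hσi hcr (hle (mem_monA'_of_fiber_le ?_ hc)) hσ hcr
    (Submonoid.subset_closure (Or.inr rfl) : f ∈ _) hf
  exact (ofNat_lt_aleph0).trans_le (aleph0_le_mk X)

/-- Functions of small range belong to every precomplete monoid containing the permutations. -/
theorem mem_of_precomplete_of_mk_range_lt {X : Type u} [Infinite X] (hsing : ¬(#X).IsRegular)
    {C : Submonoid (Function.End X)} (hC : Precomplete C) (hS : permSubmonoid X ≤ C) {f : X → X}
    (hf : #(Set.range f) < #X) : f ∈ C := by
  by_contra hfC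
  have htop := hC.2 f hfC
  have hdec : ∀ g : X → X, g ∈ C ∨ ((∃ c ∈ C, ∃ t : X → X, g = c ∘ f ∘ t) ∧
      ∃ c ∈ C, ∃ t : X → X, g = t ∘ f ∘ c) := fun g =>
    mem_closure_union_singleton (htop.ge (Submonoid.mem_top (show Function.End X from g)))
  have hfA : f ∈ monA' X := by
    refine ⟨0, aleph0_pos.trans_le (aleph0_le_mk X),
      (mk_le_mk_of_subset fun x hx => ?_).trans_lt hf⟩
    obtain ⟨⟨a, ha⟩⟩ := Cardinal.mk_ne_zero_iff.1 fun h => hx h.le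
    exact ⟨a, ha⟩
  obtain ⟨c, hcC, hcA⟩ : ∃ c ∈ C, c ∉ monA' X := by
    by_contra! hcon
    refine monA'Submonoid_ne_top X (eq_top_iff.2 (htop ▸ Submonoid.closure_le.2 ?_))
    rintro g (hg | hg)
    · exact hcon g hg
    · obtain rfl : g = f := hg
      exact hfA
  obtain ⟨d, σ, τ, -, hσ, hσi, hτi, hne⟩ := exists_doubling X
  have hcr := mk_compl_range_eq hτi hne
  have hσC : σ ∈ C := by
    rcases hdec σ with h | ⟨-, c', hc', t, h⟩
    · exact h
    · exfalso
      have : Function.Injective (Set.rangeFactorization f ∘ c') := fun a b hab => by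
        have h1 : f (c' a) = f (c' b) := congrArg Subtype.val hab
        refine hσi ?_
        rw [h]
        exact congrArg t h1
      exact absurd (mk_le_of_injective this) (not_le.2 hf)
  have hdC : d ∈ C := by
    rcases hdec d with h | ⟨⟨c', hc', t, h⟩, -⟩
    · exact h
    · exfalso
      have : Function.Surjective (fun z : Set.range f => c' z) := fun y =>
        ⟨⟨f (t (σ y)), _, rfl⟩, by
          have := hσ y
          rw [h] at this
          exact this⟩
      exact absurd (mk_le_of_surjective this) (not_le.2 hf)
  exact hC.1 (eq_top_of_generators hsing hS hσC hσi hcr hdC hσ hcr hcC hcA)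

/-- The number of points over which `f` has a fiber of size `μ`. -/
def fiberCount {X : Type u} (f : X → X) (μ : Cardinal.{u}) : Cardinal.{u} :=
  #{y : X | #(f ⁻¹' {y}) = μ}

/-- Functions with the same fiber counts are equivalent up to permutations on both sides. -/
theorem exists_perm_of_fiberCount_eq {X : Type u} {f g : X → X}
    (h : ∀ μ, fiberCount f μ = fiberCount g μ) :
    ∃ s t : Equiv.Perm X, f = s ∘ g ∘ t := by
  have e₁ : ∀ μ : Cardinal.{u}, Nonempty ({y // #(f ⁻¹' {y}) = μ} ≃ {y // #(g ⁻¹' {y}) = μ}) :=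
    fun μ => Cardinal.eq.1 (h μ)
  let σ : Equiv.Perm X := Equiv.ofFiberEquiv fun μ => (e₁ μ).some
  have hσ : ∀ y, #(g ⁻¹' {σ y}) = #(f ⁻¹' {y}) := fun y =>
    Equiv.ofFiberEquiv_map (f := fun y => #(f ⁻¹' {y})) (g := fun y => #(g ⁻¹' {y})) _ y
  have e₂ : ∀ y : X, Nonempty ({a // σ (f a) = y} ≃ {b // g b = y}) := fun y => by
    refine Cardinal.eq.1 (Eq.trans ?_
      ((hσ (σ.symm y)).symm.trans (by rw [σ.apply_symm_apply]; rfl)))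
    have : {a | σ (f a) = y} = f ⁻¹' {σ.symm y} := by
      ext a
      exact σ.eq_symm_apply.symm
    exact congrArg (fun s : Set X => #s) this
  let τ : Equiv.Perm X := Equiv.ofFiberEquiv fun y => (e₂ y).some
  have hτ : ∀ a, g (τ a) = σ (f a) := fun a =>
    Equiv.ofFiberEquiv_map (f := fun a => σ (f a)) (g := g) _ a
  refine ⟨σ.symm, τ, funext fun a => ?_⟩
  simp [hτ]

/-- The cardinals up to `#X` can be coded by elements of `X`. -/
theorem exists_cardinal_code (X : Type u) [Infinite X] :
    ∃ enc : Cardinal.{u} → X, Set.InjOn enc (Set.Iic #X) ∧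
      ∀ ξ < #X, #(enc '' Set.Iic ξ) < #X := by
  have h0 := aleph0_le_mk X
  have h1 : Cardinal.lift.{u} #(Set.Iic #X) ≤ Cardinal.lift.{u + 1} #X := by
    rw [Cardinal.lift_id'.{u, u + 1}]
    simpa [Cardinal.add_one_eq h0] using mk_Iic_cardinal_le #X
  obtain ⟨φ⟩ := Cardinal.lift_mk_le'.1 h1
  classical
  refine ⟨fun c => if h : c ≤ #X then φ ⟨c, h⟩ else Classical.arbitrary X, ?_, fun ξ hξ => ?_⟩
  · intro a ha b hb hab
    simp only [dif_pos (show a ≤ #X from ha), dif_pos (show b ≤ #X from hb)] at hab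
    exact congrArg Subtype.val (φ.injective hab)
  · rw [← Cardinal.lift_lt.{u, u + 1}]
    refine mk_image_le_lift.trans_lt ?_
    rw [Cardinal.lift_id'.{u, u + 1}]
    refine (mk_Iic_cardinal_le ξ).trans_lt (Cardinal.lift_lt.2 ?_)
    exact add_lt_of_lt h0 hξ (one_lt_aleph0.trans_le h0)

/-- The code of the graph of the fiber count of `f`. -/
def fiberCode {X : Type u} (enc : Cardinal.{u} → X) (f : X → X) : Set (X × X) :=
  Set.range fun y => (enc #(f ⁻¹' {y}), enc (fiberCount f #(f ⁻¹' {y})))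

theorem fiberCount_eq_of_fiberCode_eq {X : Type u} {enc : Cardinal.{u} → X}
    (henc : Set.InjOn enc (Set.Iic #X)) {f g : X → X} (h : fiberCode enc f = fiberCode enc g)
    (μ : Cardinal.{u}) : fiberCount f μ = fiberCount g μ := by
  have key : ∀ {f g : X → X}, fiberCode enc f = fiberCode enc g →
      ∀ y, fiberCount f #(f ⁻¹' {y}) = fiberCount g #(f ⁻¹' {y}) := by
    intro f g h y
    have hy : (enc #(f ⁻¹' {y}), enc (fiberCount f #(f ⁻¹' {y}))) ∈ fiberCode enc g :=
      h ▸ Set.mem_range_self y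
    obtain ⟨z, hz⟩ := hy
    have h1 : #(g ⁻¹' {z}) = #(f ⁻¹' {y}) :=
      henc (mk_set_le _) (mk_set_le _) (congrArg Prod.fst hz)
    have h2 : fiberCount g #(g ⁻¹' {z}) = fiberCount f #(f ⁻¹' {y}) :=
      henc (mk_set_le _) (mk_set_le _) (congrArg Prod.snd hz)
    rw [← h2, h1]
  by_cases hf : ∃ y, #(f ⁻¹' {y}) = μ
  · obtain ⟨y, rfl⟩ := hf
    exact key h y
  by_cases hg : ∃ y, #(g ⁻¹' {y}) = μ
  · obtain ⟨y, rfl⟩ := hg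
    exact (key h.symm y).symm
  have hz : ∀ k : X → X, (¬ ∃ y, #(k ⁻¹' {y}) = μ) → fiberCount k μ = 0 := fun k hk => by
    have : IsEmpty {y : X | #(k ⁻¹' {y}) = μ} := ⟨fun y => hk ⟨y, y.2⟩⟩
    exact Cardinal.mk_eq_zero _
  rw [hz f hf, hz g hg]

theorem mk_fiberCode_lt {X : Type u} [Infinite X] {enc : Cardinal.{u} → X}
    (henc : ∀ ξ < #X, #(enc '' Set.Iic ξ) < #X) (hinj : Set.InjOn enc (Set.Iic #X))
    {f : X → X} (hf : f ∈ monA' X) : #(fiberCode enc f) < #X := by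
  obtain ⟨ξ, hξ, hB⟩ := hf
  have h1 : #(fiberCode enc f) ≤ #(Set.range fun y => enc #(f ⁻¹' {y})) := by
    refine mk_le_of_injective (f := fun p : fiberCode enc f => ⟨p.1.1, ?_⟩) ?_
    · obtain ⟨_, ⟨y, rfl⟩⟩ := p
      exact ⟨y, rfl⟩
    · rintro ⟨_, ⟨y, rfl⟩⟩ ⟨_, ⟨z, rfl⟩⟩ h
      have h' : #(f ⁻¹' {y}) = #(f ⁻¹' {z}) :=
        hinj (mk_set_le _) (mk_set_le _) (congrArg Subtype.val h)
      simp [h']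
  have h2 : Set.range (fun y => enc #(f ⁻¹' {y})) ⊆
      enc '' Set.Iic ξ ∪ (fun y => enc #(f ⁻¹' {y})) '' {x : X | ¬ #(f ⁻¹' {x}) ≤ ξ} := by
    rintro _ ⟨y, rfl⟩
    by_cases h : #(f ⁻¹' {y}) ≤ ξ
    · exact Or.inl ⟨_, h, rfl⟩
    · exact Or.inr ⟨y, h, rfl⟩
  refine (h1.trans ((mk_le_mk_of_subset h2).trans (mk_union_le _ _))).trans_lt
    (add_lt_of_lt (aleph0_le_mk X) (henc ξ hξ) (mk_image_le.trans_lt hB))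

theorem le_powerlt_self {κ : Cardinal.{u}} (h0 : ℵ₀ ≤ κ) : κ ≤ κ ^< κ := by
  simpa using le_powerlt κ (one_lt_aleph0.trans_le h0)

/-- There are at most `κ ^< κ` many subsets of size `< κ` of a set of size `κ`. -/
theorem mk_small_subsets_le_s9 (Y : Type u) [Infinite Y] :
    #{t : Set Y // #t < #Y} ≤ #Y ^< #Y := by
  have h0 := aleph0_le_mk Y
  have hex : ∀ t : {t : Set Y // #t < #Y}, ∃ x : (#Y).ord.ToType, #t.1 ≤ #(Set.Iio x) := by
    intro t
    refine ⟨Ordinal.ToType.mk ⟨_, ord_lt_ord.2 t.2⟩, ?_⟩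
    simp [mk_Iio_toType]
  choose x hx using hex
  have hinj : Function.Injective fun t : {t : Set Y // #t < #Y} =>
      (⟨x t, t.1, hx t⟩ : Σ x : (#Y).ord.ToType, {t : Set Y // #t ≤ #(Set.Iio x)}) := by
    intro a b h
    simp only [Sigma.mk.injEq] at h
    obtain ⟨h1, h2⟩ := h
    apply Subtype.ext
    have : ∀ (x y : (#Y).ord.ToType) (p : {t : Set Y // #t ≤ #(Set.Iio x)}) (q : {t : Set Y // #t ≤ #(Set.Iio y)}),
        x = y → HEq p q → p.1 = q.1 := by
      rintro x _ p q rfl h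
      rw [eq_of_heq h]
    exact this _ _ _ _ h1 h2
  refine (mk_le_of_injective hinj).trans ?_
  rw [mk_sigma]
  calc Cardinal.sum (fun x : (#Y).ord.ToType => #{t : Set Y // #t ≤ #(Set.Iio x)})
      ≤ Cardinal.sum (fun _ : (#Y).ord.ToType => #Y ^< #Y) := sum_le_sum _ _ fun x =>
        (mk_bounded_set_le_of_infinite Y _).trans
          (le_powerlt _ (mk_Iio_toType_lt x))
    _ = #Y * (#Y ^< #Y) := by simp
    _ ≤ (#Y ^< #Y) * (#Y ^< #Y) := mul_le_mul' (le_powerlt_self h0) le_rfl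
    _ = #Y ^< #Y := mul_eq_self (h0.trans (le_powerlt_self h0))

theorem mk_interval_le {X : Type u} [Infinite X] {D : Submonoid (Function.End X)}
    (hD : D ≤ monA'Submonoid X) :
    #{M : Submonoid (Function.End X) // permSubmonoid X ≤ M ∧ M ≤ D} ≤
      (2 : Cardinal.{u}) ^ (#X ^< #X) := by
  obtain ⟨enc, hinj, hsmall⟩ := exists_cardinal_code X
  have hXX : #(X × X) = #X := by simp
  let Φ : {M : Submonoid (Function.End X) // permSubmonoid X ≤ M ∧ M ≤ D} →
      Set {t : Set (X × X) // #t < #(X × X)} := fun M => {t | ∃ f ∈ M.1, fiberCode enc f = t.1}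
  have hle : ∀ M N, Φ M = Φ N → M.1 ≤ N.1 := by
    intro M N h f hf
    have hmem : (⟨fiberCode enc f, hXX.symm ▸ mk_fiberCode_lt hsmall hinj (hD (M.2.2 hf))⟩ :
        {t : Set (X × X) // #t < #(X × X)}) ∈ Φ N := by
      rw [← h]
      exact ⟨f, hf, rfl⟩
    obtain ⟨g, hg, hgf⟩ := hmem
    obtain ⟨s, t, hst⟩ := exists_perm_of_fiberCount_eq
      (fiberCount_eq_of_fiberCode_eq hinj hgf.symm)
    rw [show f = _ from hst]
    exact comp_mem (perm_mem N.2.1 s) (comp_mem hg (perm_mem N.2.1 t))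
  have hΦ : Function.Injective Φ := fun M N h =>
    Subtype.ext (le_antisymm (hle M N h) (hle N M h.symm))
  refine (mk_le_of_injective hΦ).trans ?_
  rw [mk_set]
  refine power_le_power_left two_ne_zero ?_
  rw [← hXX]
  exact mk_small_subsets_le_s9 (X × X)

/-- If `#α = ℵ_α` is singular, there are `ℵ_α` many successor cardinals below it, and they can
be distributed over `ℵ_α` many unbounded families with a common small index type. -/
theorem exists_successor_cardinals {α : Ordinal.{u}} {κ : Cardinal.{u}} (hκα : κ = ℵ_ α)
    (hsing : ¬κ.IsRegular) (hlam : max α.card ℵ₀ = κ) {Y : Type u} (hY : #Y ≤ κ) :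
    ∃ (W : Type u) (a : Y × W → Cardinal.{u}), #W < κ ∧ Function.Injective a ∧
      (∀ p, ∃ μ, ℵ₀ ≤ μ ∧ a p = Order.succ μ) ∧ (∀ p, a p < κ) ∧
      ∀ c < κ, ∃ w, ∀ y, c < a (y, w) := by
  have h0 : ℵ₀ ≤ κ := hκα ▸ aleph0_le_aleph α
  have hκ0 : κ ≠ ℵ₀ := fun h => hsing (h ▸ isRegular_aleph0)
  have hcard : α.card = κ := by
    rcases max_choice α.card ℵ₀ with h | h
    · exact h.symm.trans hlam
    · exact absurd (hlam.symm.trans h) hκ0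
  have hα : κ.ord ≤ α := by
    rw [ord_le, hcard]
  let size : κ.ord.ToType → Cardinal.{u} := fun e => Order.succ (ℵ_ e.toOrd)
  have hsize : Function.Injective size := fun e e' h =>
    Ordinal.ToType.mk.symm.injective (Subtype.ext (aleph.injective (Order.succ_injective h)))
  have hsize_lt : ∀ e, size e < κ := fun e => by
    refine lt_of_le_of_ne (Order.succ_le_of_lt ?_) fun h =>
      hsing (h ▸ isRegular_succ (aleph0_le_aleph _))
    exact (aleph_lt_aleph.2 (e.toOrd.2.trans_le hα)).trans_eq hκα.symm
  have hlt_size : ∀ e, #(Set.Iio e) < size e := fun e => by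
    refine Order.lt_succ_of_le ?_
    rw [mk_Iio_toType, ← card_ord (ℵ_ _), ord_aleph]
    exact Ordinal.card_le_card (Ordinal.le_omega_self _)
  obtain ⟨W, hW, hcof⟩ := exists_small_cofinal h0 hsing
  have hT : #κ.ord.ToType = κ := mk_ord_toType κ
  obtain ⟨φ, hφ, hφW⟩ := exists_injective_choice (fun i : Y × W => Set.Ioi i.2.1) fun i => by
    have : Infinite κ.ord.ToType := infinite_iff.2 (h0.trans hT.ge)
    rw [← Set.compl_Iic, mk_compl_of_infinite _ ((mk_Iic_lt_of_infinite h0 _).trans_le hT.ge), hT]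
    simpa using mul_le_of_le h0 hY hW.le
  refine ⟨W, fun i => size (φ i), hW, hsize.comp hφ, fun p => ⟨_, aleph0_le_aleph _, rfl⟩,
    fun p => hsize_lt _, fun c hc => ?_⟩
  obtain ⟨w, hw, hcw⟩ := hcof (Ordinal.ToType.mk ⟨c.ord, ord_lt_ord.2 hc⟩)
  refine ⟨⟨w, hw⟩, fun y => ?_⟩
  refine lt_of_le_of_lt ?_ (hlt_size (φ (y, ⟨w, hw⟩)))
  have h1 : c = #(Set.Iio (Ordinal.ToType.mk ⟨c.ord, ord_lt_ord.2 hc⟩ : κ.ord.ToType)) := by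
    simp [mk_Iio_toType]
  rw [h1]
  exact mk_le_mk_of_subset (Set.Iio_subset_Iio (hcw.trans (le_of_lt (hφW (y, ⟨w, hw⟩)))))

/-- A function with prescribed fiber sizes. -/
theorem exists_function_of_fiber_sizes {X J : Type u} (hJ : #J ≤ #X) (a : J → Cardinal.{u})
    (ha : Cardinal.sum a = #X) :
    ∃ (f : X → X) (emb : J → X), #(Set.range f) ≤ #J ∧ (∀ j, #(f ⁻¹' {emb j}) = a j) ∧
      ∀ x, ∃ j, f x = emb j := by
  obtain ⟨emb⟩ : Nonempty (J ↪ X) := hJ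
  obtain ⟨e⟩ : Nonempty (X ≃ Σ j, (a j).out) := Cardinal.eq.1 (by simp [← ha])
  refine ⟨fun x => emb (e x).1, emb, ?_, fun j => ?_, fun x => ⟨_, rfl⟩⟩
  · refine le_trans (mk_le_mk_of_subset ?_) (mk_range_le (f := emb))
    rintro _ ⟨x, rfl⟩
    exact ⟨_, rfl⟩
  · have h : (fun x => emb (e x).1) ⁻¹' {emb j} = e ⁻¹' Set.range (Sigma.mk j) := by
      ext x
      simp only [Set.mem_preimage, Set.mem_singleton_iff, emb.injective.eq_iff, Set.mem_range]
      constructor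
      · rintro rfl
        exact ⟨_, rfl⟩
      · rintro ⟨z, hz⟩
        rw [← hz]
    rw [h, mk_preimage_equiv, mk_range_eq _ sigma_mk_injective, mk_out]

/-- A fiber of infinite successor size of `t ∘ g ∘ s` comes from a fiber of `g` of that size,
if the range of `g` is smaller. -/
theorem exists_fiber_of_comp {X : Type u} {g t : X → X} {s : X → X} (hs : Function.Bijective s)
    {μ : Cardinal.{u}} (hμ : ℵ₀ ≤ μ) (hg : #(Set.range g) ≤ μ) {y : X}
    (hy : #((t ∘ g ∘ s) ⁻¹' {y}) = Order.succ μ) :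
    ∃ z ∈ Set.range g, #(g ⁻¹' {z}) = Order.succ μ := by
  have h1 : #(g ⁻¹' (t ⁻¹' {y})) = Order.succ μ := by
    rw [← hy]
    exact (mk_preimage_equiv (Equiv.ofBijective s hs) _).symm
  have hpre : g ⁻¹' (t ⁻¹' {y}) = g ⁻¹' (t ⁻¹' {y} ∩ Set.range g) := by simp
  by_contra! hcon
  have h2 : #(g ⁻¹' (t ⁻¹' {y} ∩ Set.range g)) ≤ #(t ⁻¹' {y} ∩ Set.range g : Set X) * μ := by
    refine mk_preimage_le_mul g _ fun z hz => Order.le_of_lt_succ (lt_of_le_of_ne ?_ (hcon z hz.2))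
    rw [← h1]
    refine mk_le_mk_of_subset fun x hx => ?_
    obtain rfl : g x = z := hx
    exact hz.1
  rw [← hpre, h1] at h2
  have h3 : #(t ⁻¹' {y} ∩ Set.range g : Set X) * μ ≤ μ :=
    mul_le_of_le hμ ((mk_le_mk_of_subset Set.inter_subset_right).trans hg) le_rfl
  exact absurd (h2.trans h3) (not_le.2 (Order.lt_succ μ))

/-- The monoid generated by a set of functions and all permutations. -/
def permClosure {X : Type u} (F : Set (X → X)) : Submonoid (Function.End X) :=
  Submonoid.closure ((permSubmonoid X : Set (Function.End X)) ∪ {g | g ∈ F})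

theorem bijective_or_exists_of_mem_permClosure {X : Type u} {F : Set (X → X)} {g : X → X}
    (hg : g ∈ permClosure F) :
    Function.Bijective g ∨
      ∃ f ∈ F, ∃ t s : X → X, Function.Bijective s ∧ g = t ∘ f ∘ s := by
  refine Submonoid.closure_induction (M := Function.End X)
    (motive := fun (g : X → X) _ => Function.Bijective g ∨
      ∃ f ∈ F, ∃ t s : X → X, Function.Bijective s ∧ g = t ∘ f ∘ s) ?_ ?_ ?_ hg
  · rintro g (h | h)
    · exact Or.inl h
    · exact Or.inr ⟨g, h, id, id, Function.bijective_id, rfl⟩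
  · exact Or.inl Function.bijective_id
  · rintro x y - - hx (hy | ⟨f, hf, t, s, hs, rfl⟩)
    · rcases hx with hx | ⟨f, hf, t, s, hs, rfl⟩
      · exact Or.inl (hx.comp hy)
      · exact Or.inr ⟨f, hf, t, s ∘ y, hs.comp hy, rfl⟩
    · exact Or.inr ⟨f, hf, x ∘ t, s, hs, rfl⟩

/-- A family of functions none of which factors through another one yields as many monoids as
there are subsets of its index type. -/
theorem le_mk_interval {X I : Type u} {D : Submonoid (Function.End X)} (hD : permSubmonoid X ≤ D)
    (f : I → X → X) (hf : ∀ i, f i ∈ D) (hb : ∀ i, ¬ Function.Bijective (f i))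
    (hne : ∀ i j (t s : X → X), Function.Bijective s → f i = t ∘ f j ∘ s → i = j) :
    (2 : Cardinal.{u}) ^ #I ≤ #{M : Submonoid (Function.End X) // permSubmonoid X ≤ M ∧ M ≤ D} := by
  have hmem : ∀ (A : Set I) i, f i ∈ permClosure (f '' A) ↔ i ∈ A := by
    intro A i
    refine ⟨fun h => ?_, fun h => Submonoid.subset_closure (Or.inr ⟨i, h, rfl⟩)⟩
    rcases bijective_or_exists_of_mem_permClosure h with h | ⟨_, ⟨j, hj, rfl⟩, t, s, hs, h⟩
    · exact absurd h (hb i)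
    · rwa [hne i j t s hs h]
  rw [← mk_set]
  refine mk_le_of_injective (f := fun A : Set I =>
    ⟨permClosure (f '' A), fun g hg => Submonoid.subset_closure (Or.inl hg), ?_⟩) ?_
  · refine Submonoid.closure_le.2 ?_
    rintro g (hg | ⟨i, -, rfl⟩)
    · exact hD hg
    · exact hf i
  · intro A B h
    ext i
    have h' : permClosure (f '' A) = permClosure (f '' B) := congrArg Subtype.val h
    exact (hmem A i).symm.trans ((SetLike.ext_iff.1 h' (f i)).trans (hmem B i))

theorem powerlt_le_mk_sigma {κ : Cardinal.{u}} (h0 : ℵ₀ ≤ κ) :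
    κ ^< κ ≤ #(Σ x : κ.ord.ToType, (Set.Iic x → κ.ord.ToType)) := by
  refine powerlt_le.2 fun ξ hξ => ?_
  let x : κ.ord.ToType := Ordinal.ToType.mk ⟨ξ.ord, ord_lt_ord.2 hξ⟩
  have hx : ξ ≤ #(Set.Iic x) := by
    have h1 : #(Set.Iio x) = ξ := by simp [mk_Iio_toType, x]
    rw [← h1]
    exact mk_le_mk_of_subset Set.Iio_subset_Iic_self
  refine le_trans ?_ (mk_le_of_injective (sigma_mk_injective (i := x)))
  rw [← power_def, mk_ord_toType]
  exact power_le_power_left (aleph0_pos.trans_le h0).ne' hx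

/-- A sum of at most `κ` cardinals up to `κ` which are unbounded in `κ` is `κ`. -/
theorem sum_eq_of_unbounded {J : Type u} {κ : Cardinal.{u}} (h0 : ℵ₀ ≤ κ) (hJ : #J ≤ κ)
    {a : J → Cardinal.{u}} (ha : ∀ j, a j ≤ κ) (hu : ∀ c < κ, ∃ j, c < a j) :
    Cardinal.sum a = κ := by
  refine le_antisymm ?_ (le_of_forall_lt fun c hc => ?_)
  · refine (sum_le_sum _ (fun _ => κ) ha).trans ?_
    rw [sum_const']
    exact mul_le_of_le h0 hJ le_rfl
  · obtain ⟨j, hj⟩ := hu c hc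
    exact hj.trans_le (le_sum a j)

theorem exists_independent_family {X : Type u} [Infinite X] {α : Ordinal.{u}}
    (hκα : #X = ℵ_ α) (hsing : ¬(#X).IsRegular) (hlam : max α.card ℵ₀ = #X) :
    ∃ f : (Σ x : (#X).ord.ToType, (Set.Iic x → (#X).ord.ToType)) → X → X,
      (∀ i, #(Set.range (f i)) < #X) ∧
      ∀ i j (t s : X → X), Function.Bijective s → f i = t ∘ f j ∘ s → i = j := by
  have h0 := aleph0_le_mk X
  have hT : #(#X).ord.ToType = #X := mk_ord_toType _
  have hY : #((#X).ord.ToType × (#X).ord.ToType × (#X).ord.ToType) ≤ #X := by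
    simp [mul_eq_self h0]
  obtain ⟨W, a, hW, hinj, hsucc, hlt, hunb⟩ := exists_successor_cardinals hκα hsing hlam hY
  have hJ : ∀ x : (#X).ord.ToType, #(Set.Iic x × W) < #X := fun x => by
    simpa using mul_lt_of_lt h0 (mk_Iic_lt_of_infinite h0 x) hW
  have hex : ∀ i : (Σ x : (#X).ord.ToType, (Set.Iic x → (#X).ord.ToType)), _ := fun i =>
    exists_function_of_fiber_sizes (hJ i.1).le (fun j : Set.Iic i.1 × W =>
      a ((i.1, j.1.1, i.2 j.1), j.2)) (sum_eq_of_unbounded h0 (hJ i.1).le (fun j => (hlt _).le)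
        fun c hc => (hunb c hc).imp' (fun w => (⟨i.1, Set.self_mem_Iic⟩, w)) fun w hw => hw _)
  choose f emb hrange hfib hemb using hex
  have hr : ∀ i, #(Set.range (f i)) < #X := fun i => (hrange i).trans_lt (hJ i.1)
  refine ⟨f, hr, fun i j t s hs h => ?_⟩
  have hall : ∀ y : Set.Iic i.1, ∃ z : Set.Iic j.1,
      (j.1, z.1, j.2 z) = (i.1, y.1, i.2 y) := by
    intro y
    obtain ⟨w, hw⟩ := hunb _ (hr j)
    obtain ⟨μ, hμ, hμa⟩ := hsucc ((i.1, y.1, i.2 y), w)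
    have hrμ : #(Set.range (f j)) ≤ μ := Order.le_of_lt_succ (hμa ▸ hw _)
    have h1 := (hfib i (y, w)).trans hμa
    rw [h] at h1
    obtain ⟨_, ⟨x, rfl⟩, hx⟩ := exists_fiber_of_comp hs hμ hrμ h1
    obtain ⟨k, hk⟩ := hemb j x
    rw [hk, hfib j k, ← hμa] at hx
    exact ⟨k.1, congrArg Prod.fst (hinj hx)⟩
  obtain ⟨x, hx⟩ := i
  obtain ⟨x', hx'⟩ := j
  obtain ⟨_, h1⟩ := hall ⟨x, Set.self_mem_Iic⟩
  obtain rfl : x' = x := congrArg Prod.fst h1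
  congr 1
  funext y
  obtain ⟨z, hz⟩ := hall y
  obtain rfl : z = y := Subtype.ext (congrArg (fun p => p.2.1) hz)
  exact (congrArg (fun p => p.2.2) hz).symm

/-- On an infinite set of singular cardinality `κ = ℵ_α` with `λ = max(|α|, ℵ₀) = κ`, the
interval `[S, D]` has cardinality `2^(κ^{<κ})`, where `D` is the intersection of all
precomplete submonoids containing the permutations. -/
theorem card_interval_S_D_singular_large_lambda {X : Type u} [Infinite X] {α : Ordinal.{u}}
    {κ : Cardinal.{u}} (hκ : #X = κ) (hκα : κ = Cardinal.aleph α) (hsing : ¬κ.IsRegular)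
    (hlam : max α.card ℵ₀ = κ)
    (D : Submonoid (Function.End X))
    (hD : D = sInf {C : Submonoid (Function.End X) | Precomplete C ∧ permSubmonoid X ≤ C}) :
    #{M : Submonoid (Function.End X) // permSubmonoid X ≤ M ∧ M ≤ D} =
      (2 : Cardinal.{u}) ^ (κ ^< κ) := by
  subst hκ hD
  refine le_antisymm
    (mk_interval_le (sInf_le ⟨precomplete_monA' hsing, permSubmonoid_le_monA' X⟩)) ?_
  obtain ⟨f, hf, hne⟩ := exists_independent_family hκα hsing hlam
  refine (power_le_power_left two_ne_zero (powerlt_le_mk_sigma (aleph0_le_mk X))).trans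
    (le_mk_interval (le_sInf fun C hC => hC.2) f (fun i => ?_) (fun i h => ?_) hne)
  · exact (Submonoid.mem_sInf (M := Function.End X)).2 fun C hC =>
      mem_of_precomplete_of_mk_range_lt hsing hC.1 hC.2 (hf i)
  · have := hf i
    rw [h.2.range_eq, mk_univ] at this
    exact lt_irrefl _ this
end
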